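/- For every smooth function f ∈ C^∞(𝕋²) and every R > 0, ∫_{𝕋²} ∫_{ℝ² \ B_R} |f(x+z) − f(x)|²/|z|³ dz dx ≤ (2π ‖f‖_∞ / R) · min{ 4‖f‖_∞, ∫_{𝕋²} |∇f| dx }, where B_R ⊂ ℝ² is the open ball of radius R centered at 0 and ‖f‖_∞ is the supremum norm of f. -/

import Mathlib

open MeasureTheory Real

noncomputable section

/-- The plane `ℝ²`, modeled as functions `Fin 2 → ℝ`. -/
abbrev R2 : Type := Fin 2 → ℝ

/-- A fundamental domain for the unit torus `𝕋² = ℝ²/ℤ²`. -/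
def cube : Set R2 := Set.univ.pi fun _ => Set.Ico (0 : ℝ) 1

/-- `ℤ²`-periodicity: functions on the torus `𝕋²`. -/
def Per (f : R2 → ℝ) : Prop :=
  ∀ (x : R2) (n : Fin 2 → ℤ), f (x + fun i => (n i : ℝ)) = f x

/-- The Euclidean norm on `ℝ²`. -/
def en2 (z : R2) : ℝ := Real.sqrt (∑ i, z i ^ 2)

/-- `|∇f(x)|²`, the squared Euclidean norm of the gradient. -/
def gradNormSq (f : R2 → ℝ) (x : R2) : ℝ :=
  ∑ j, (fderiv ℝ f x (Pi.single j 1)) ^ 2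

/-- `|∇f(x)|`, the Euclidean norm of the gradient. -/
def gradNorm (f : R2 → ℝ) (x : R2) : ℝ := Real.sqrt (gradNormSq f x)

/-- The supremum norm `‖f‖_∞`. -/
def supNorm (f : R2 → ℝ) : ℝ := ⨆ x : R2, |f x|

/-- The squared homogeneous `H^{1/2}` seminorm on the torus (real-space formula). -/
def H12 (f : R2 → ℝ) : ℝ :=
  (1 / (4 * π)) * ∫ x in cube, ∫ z : R2, (f (x + z) - f x) ^ 2 / en2 z ^ 3


def phi (R : ℝ) : ℝ → ℝ := Set.indicator (Set.Ici R) (fun r => 1 / r ^ 3)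

lemma en2_eq_norm (z : R2) : en2 z = ‖(WithLp.toLp 2 z : EuclideanSpace ℝ (Fin 2))‖ := by
  simp [en2, EuclideanSpace.norm_eq]

lemma phi_smul (R : ℝ) (hR : 0 < R) (y : ℝ) :
    y ^ (Module.finrank ℝ (EuclideanSpace ℝ (Fin 2)) - 1) • phi R y
      = (Set.Ici R).indicator (fun t : ℝ => t ^ (-2 : ℝ)) y := by
  by_cases h : y ∈ Set.Ici R
  · have hy : 0 < y := lt_of_lt_of_le hR h
    rw [phi, Set.indicator_of_mem h, Set.indicator_of_mem h, Real.rpow_neg hy.le]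
    simp
    field_simp
  · rw [phi, Set.indicator_of_notMem h, Set.indicator_of_notMem h, smul_zero]

lemma ker_integrable (R : ℝ) (hR : 0 < R) : Integrable (fun z : R2 => phi R (en2 z)) := by
  have h1 : Integrable (fun z : EuclideanSpace ℝ (Fin 2) => phi R ‖z‖) := by
    rw [integrable_fun_norm_addHaar volume]
    simp_rw [phi_smul R hR]
    apply Integrable.integrableOn
    rw [integrable_indicator_iff measurableSet_Ici, integrableOn_Ici_iff_integrableOn_Ioi]
    exact integrableOn_Ioi_rpow_of_lt (by norm_num) hR
  have h2 := (PiLp.volume_preserving_toLp (Fin 2)).integrable_comp_emb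
    (MeasurableEquiv.toLp 2 _).measurableEmbedding (g := fun z : EuclideanSpace ℝ (Fin 2) => phi R ‖z‖)
  have h3 := h2.2 h1
  simpa only [Function.comp_def, ← en2_eq_norm] using h3

lemma ker_integral (R : ℝ) (hR : 0 < R) : ∫ z : R2, phi R (en2 z) = 2 * π / R := by
  have h2 := (PiLp.volume_preserving_toLp (Fin 2)).integral_comp
    (MeasurableEquiv.toLp 2 _).measurableEmbedding (fun z : EuclideanSpace ℝ (Fin 2) => phi R ‖z‖)
  simp only [← en2_eq_norm] at h2
  rw [h2, integral_fun_norm_addHaar volume]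
  simp_rw [phi_smul R hR]
  rw [setIntegral_indicator measurableSet_Ici]
  have : Set.Ioi (0:ℝ) ∩ Set.Ici R = Set.Ici R :=
    Set.inter_eq_right.2 (fun x hx => lt_of_lt_of_le hR hx)
  rw [this, integral_Ici_eq_integral_Ioi, integral_Ioi_rpow_of_lt (by norm_num) hR]
  rw [measureReal_def, EuclideanSpace.volume_ball_fin_two]
  norm_num
  rw [Real.rpow_neg_one]
  simp [Real.pi_pos.le]
  field_simp

lemma measurableSet_cube : MeasurableSet cube :=
  MeasurableSet.univ_pi fun _ => measurableSet_Ico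

lemma volume_cube : volume cube = 1 := by
  simp [cube, volume_pi, Measure.pi_pi]

instance : IsProbabilityMeasure (volume.restrict cube : Measure R2) :=
  ⟨by simp [volume_cube]⟩

lemma cube_subset : cube ⊆ Set.Icc (0 : R2) 1 := by
  intro x hx
  exact ⟨fun i => (hx i trivial).1, fun i => (hx i trivial).2.le⟩

lemma intOn_cube {g : R2 → ℝ} (hg : Continuous g) : Integrable g (volume.restrict cube) :=
  (hg.continuousOn.integrableOn_compact isCompact_Icc).mono_set cube_subset

lemma cube_translate {g : R2 → ℝ} (hg : Per g) (v : R2) :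
    ∫ x in cube, g (x + v) = ∫ x in cube, g x := by
  have hc : ZSpan.fundamentalDomain (Pi.basisFun ℝ (Fin 2)) = cube :=
    ZSpan.fundamentalDomain_pi_basisFun
  have h1 := ZSpan.isAddFundamentalDomain (Pi.basisFun ℝ (Fin 2)) (volume : Measure R2)
  rw [hc] at h1
  have h2 := h1.vadd_of_comm v
  have : VAddInvariantMeasure (Submodule.span ℤ (Set.range (Pi.basisFun ℝ (Fin 2)))) (Fin 2 → ℝ)
      volume := inferInstanceAs <| VAddInvariantMeasure
        (Submodule.span ℤ (Set.range (Pi.basisFun ℝ (Fin 2)))).toAddSubgroup (Fin 2 → ℝ) volume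
  have h3 := h1.setIntegral_eq h2 (f := g) (by
    rintro ⟨n, hn⟩ x
    obtain ⟨c, rfl⟩ := (Submodule.mem_span_range_iff_exists_fun _).mp hn
    have : (∑ i, c i • (Pi.basisFun ℝ (Fin 2)) i) = fun i => (c i : ℝ) := by
      ext j
      simp [Finset.sum_apply, Pi.single_apply]
    rw [Submodule.vadd_def, vadd_eq_add]
    simp only [this]
    rw [add_comm]
    exact hg x c)
  rw [h3]
  have h4 := (measurePreserving_add_right (volume : Measure R2) v).setIntegral_image_emb
    (measurableEmbedding_addRight v) g cube
  rw [← h4]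
  congr 2
  ext y
  simp only [Set.mem_vadd_set, Set.mem_image, vadd_eq_add, add_comm]

lemma f_bdd {f : R2 → ℝ} (hf : Continuous f) (hper : Per f) : BddAbove (Set.range fun x => |f x|) := by
  obtain ⟨C, hC⟩ := (isCompact_Icc (a := (0 : R2)) (b := 1)).bddAbove_image (f := fun x => |f x|)
    hf.abs.continuousOn
  refine ⟨C, ?_⟩
  rintro _ ⟨x, rfl⟩
  have := hper (fun i => Int.fract (x i)) (fun i => ⌊x i⌋)
  have hx : ((fun i => Int.fract (x i)) + fun i => ((⌊x i⌋ : ℤ) : ℝ)) = x := by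
    ext i; simp
  rw [hx] at this
  simp only [this]
  exact hC ⟨_, ⟨fun i => Int.fract_nonneg _, fun i => (Int.fract_lt_one _).le⟩, rfl⟩

lemma abs_le_sup {f : R2 → ℝ} (hf : Continuous f) (hper : Per f) (x : R2) : |f x| ≤ supNorm f :=
  le_ciSup (f_bdd hf hper) x

lemma fderiv_per {f : R2 → ℝ} (hper : Per f) (x : R2) (n : Fin 2 → ℤ) :
    fderiv ℝ f (x + fun i => (n i : ℝ)) = fderiv ℝ f x := by
  have : (fun y => f (y + fun i => (n i : ℝ))) = f := funext fun y => hper y n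
  rw [← fderiv_comp_add_right, this]

lemma diff_le {f : R2 → ℝ} (hf : ContDiff ℝ (⊤ : ℕ∞) f) (hper : Per f) (w : R2) :
    ∫ x in cube, |f (x + w) - f x| ≤ ∫ x in cube, |fderiv ℝ f x w| := by
  have hdc : Continuous (fderiv ℝ f) := hf.continuous_fderiv (by simp)
  have hfd : Differentiable ℝ f := hf.differentiable (by simp)
  have hcont : Continuous (fun p : ℝ × R2 => |fderiv ℝ f (p.2 + p.1 • w) w|) := by fun_prop
  have hpt : ∀ x, |f (x + w) - f x| ≤ ∫ t in (0:ℝ)..1, |fderiv ℝ f (x + t • w) w| := by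
    intro x
    have hd : ∀ t ∈ Set.uIcc (0:ℝ) 1, HasDerivAt (fun t : ℝ => f (x + t • w))
        (fderiv ℝ f (x + t • w) w) t := by
      intro t _
      have h1 : HasDerivAt (fun t : ℝ => x + t • w) w t := by
        simpa using ((hasDerivAt_id t).smul_const w).const_add x
      exact (hfd (x + t • w)).hasFDerivAt.comp_hasDerivAt t h1
    have hi := intervalIntegral.integral_eq_sub_of_hasDerivAt hd
      (Continuous.intervalIntegrable (by fun_prop) _ _)
    simp only [one_smul, zero_smul, add_zero] at hi
    rw [← hi]
    exact intervalIntegral.abs_integral_le_integral_abs zero_le_one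
  have hint : Integrable (Function.uncurry fun (t : ℝ) (x : R2) => |fderiv ℝ f (x + t • w) w|)
      ((volume.restrict (Set.uIoc (0:ℝ) 1)).prod (volume.restrict cube)) := by
    rw [Measure.prod_restrict]
    refine IntegrableOn.mono_set (t := Set.Icc 0 1 ×ˢ Set.Icc 0 1) ?_ ?_
    · exact hcont.continuousOn.integrableOn_compact (isCompact_Icc.prod isCompact_Icc)
    · refine Set.prod_mono ?_ cube_subset
      rw [Set.uIoc_of_le zero_le_one]
      exact Set.Ioc_subset_Icc_self
  have hsw := intervalIntegral_integral_swap hint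
  have hR : ∫ x in cube, (∫ t in (0:ℝ)..1, |fderiv ℝ f (x + t • w) w|)
      = ∫ x in cube, |fderiv ℝ f x w| := by
    rw [← hsw]
    have : ∀ t : ℝ, ∫ x in cube, |fderiv ℝ f (x + t • w) w| = ∫ x in cube, |fderiv ℝ f x w| := by
      intro t
      exact cube_translate (g := fun x => |fderiv ℝ f x w|)
        (fun x n => by simp only [fderiv_per hper]) (t • w)
    simp [this]
  rw [← hR]
  have hfc := hf.continuous
  refine integral_mono (intOn_cube (by fun_prop)) (intOn_cube ?_) hpt
  exact intervalIntegral.continuous_parametric_intervalIntegral_of_continuous' (by fun_prop) 0 1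

def refl2 (z : R2) : R2 := fun i => if i = 0 then z i else - z i

lemma en2_refl (z : R2) : en2 (refl2 z) = en2 z := by
  simp [en2, refl2]

lemma refl_mp : MeasurePreserving refl2 volume volume := by
  refine volume_preserving_pi (f := fun i (t : ℝ) => if i = 0 then t else - t) fun i => ?_
  by_cases h : i = 0
  · simp only [h, if_true]; exact MeasurePreserving.id _
  · simp only [h, if_false]; exact Measure.measurePreserving_neg _

lemma refl_emb : MeasurableEmbedding refl2 := by
  have hm : Measurable refl2 := refl_mp.measurable
  have hi : ∀ z, refl2 (refl2 z) = z := by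
    intro z; ext i; by_cases h : i = 0 <;> simp [refl2, h]
  exact (MeasurableEquiv.mk ⟨refl2, refl2, hi, hi⟩ hm hm).measurableEmbedding

def DD (f : R2 → ℝ) (z : R2) : ℝ := ∫ x in cube, (f (x + z) - f x) ^ 2

lemma DD_per {f : R2 → ℝ} (hper : Per f) (z : R2) (n : Fin 2 → ℤ) :
    DD f (z + fun i => (n i : ℝ)) = DD f z := by
  have h : ∀ x : R2, f (x + (z + fun i => (n i : ℝ))) = f (x + z) := fun x => by
    rw [← add_assoc]; exact hper _ n
  simp only [DD, h]

lemma DD_le {f : R2 → ℝ} (hf : ContDiff ℝ (⊤ : ℕ∞) f) (hper : Per f) (w : R2) :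
    DD f w ≤ 2 * supNorm f * ∫ x in cube, |fderiv ℝ f x w| := by
  have hfc := hf.continuous
  have hM := abs_le_sup hfc hper
  have hM0 : 0 ≤ supNorm f := (abs_nonneg _).trans (hM 0)
  refine le_trans ?_ (mul_le_mul_of_nonneg_left (diff_le hf hper w) (by positivity))
  rw [← integral_const_mul]
  refine integral_mono (intOn_cube (by fun_prop)) (intOn_cube (by fun_prop)) fun x => ?_
  have h1 : |f (x + w) - f x| ≤ 2 * supNorm f := by
    have := abs_sub (f (x + w)) (f x)
    linarith [hM (x + w), hM x]
  show (f (x + w) - f x) ^ 2 ≤ 2 * supNorm f * |f (x + w) - f x|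
  rw [← sq_abs, sq]
  exact mul_le_mul_of_nonneg_right h1 (abs_nonneg _)

lemma grad_pt (f : R2 → ℝ) (x w : R2) (hw : ∀ i, |w i| ≤ 1 / 2) :
    |fderiv ℝ f x w| + |fderiv ℝ f x (refl2 w)| ≤ gradNorm f x := by
  have e1 : w = w 0 • Pi.single 0 (1:ℝ) + w 1 • Pi.single 1 (1:ℝ) := by
    ext i; fin_cases i <;> simp
  have e2 : refl2 w = w 0 • Pi.single 0 (1:ℝ) - w 1 • Pi.single 1 (1:ℝ) := by
    ext i; fin_cases i <;> simp [refl2]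
  have d1 : fderiv ℝ f x w = w 0 * fderiv ℝ f x (Pi.single 0 1) + w 1 * fderiv ℝ f x (Pi.single 1 1) := by
    conv_lhs => rw [e1]
    simp
  have d2 : fderiv ℝ f x (refl2 w)
      = w 0 * fderiv ℝ f x (Pi.single 0 1) - w 1 * fderiv ℝ f x (Pi.single 1 1) := by
    rw [e2]; simp
  rw [d1, d2]
  have hg : gradNorm f x = √((fderiv ℝ f x (Pi.single 0 1)) ^ 2 + (fderiv ℝ f x (Pi.single 1 1)) ^ 2) := by
    simp [gradNorm, gradNormSq]
  rw [hg]
  generalize fderiv ℝ f x (Pi.single 0 1) = a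
  generalize fderiv ℝ f x (Pi.single 1 1) = b
  have ha : |a| ≤ √(a ^ 2 + b ^ 2) := Real.abs_le_sqrt (by nlinarith [sq_nonneg b])
  have hb : |b| ≤ √(a ^ 2 + b ^ 2) := Real.abs_le_sqrt (by nlinarith [sq_nonneg a])
  have h0 : 2 * |w 0 * a| ≤ √(a ^ 2 + b ^ 2) := by
    rw [abs_mul]; nlinarith [hw 0, abs_nonneg a]
  have h1 : 2 * |w 1 * b| ≤ √(a ^ 2 + b ^ 2) := by
    rw [abs_mul]; nlinarith [hw 1, abs_nonneg b]
  generalize w 0 * a = p at *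
  generalize w 1 * b = q at *
  have := abs_le.1 (le_refl |p|)
  have := abs_le.1 (le_refl |q|)
  rcases abs_cases (p + q) with h | h <;> rcases abs_cases (p - q) with h' | h' <;> linarith

lemma gradNorm_cont {f : R2 → ℝ} (hf : ContDiff ℝ (⊤ : ℕ∞) f) : Continuous (gradNorm f) := by
  have hdc : Continuous (fderiv ℝ f) := hf.continuous_fderiv (by simp)
  unfold gradNorm gradNormSq
  fun_prop

lemma DD_pair {f : R2 → ℝ} (hf : ContDiff ℝ (⊤ : ℕ∞) f) (hper : Per f) (z : R2) :
    DD f z + DD f (refl2 z) ≤ 2 * supNorm f * ∫ x in cube, gradNorm f x := by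
  have hdc : Continuous (fderiv ℝ f) := hf.continuous_fderiv (by simp)
  have hM0 : 0 ≤ supNorm f := (abs_nonneg _).trans (abs_le_sup hf.continuous hper 0)
  set w : R2 := fun i => z i - (round (z i) : ℤ) with hw
  have hw2 : ∀ i, |w i| ≤ 1 / 2 := fun i => abs_sub_round (z i)
  have ez : z = w + fun i => ((round (z i) : ℤ) : ℝ) := by ext i; simp [hw]
  have ez' : refl2 z = refl2 w + fun i => (((if i = 0 then round (z i) else - round (z i)) : ℤ) : ℝ) := by
    ext i; by_cases h : i = 0 <;> simp [refl2, hw, h] <;> ring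
  have h1 : DD f z = DD f w := by
    conv_lhs => rw [ez]
    exact DD_per hper w _
  have h2 : DD f (refl2 z) = DD f (refl2 w) := by
    rw [ez']
    exact DD_per hper (refl2 w) _
  rw [h1, h2]
  refine (add_le_add (DD_le hf hper w) (DD_le hf hper (refl2 w))).trans ?_
  rw [← mul_add, ← integral_add (intOn_cube (by fun_prop)) (intOn_cube (by fun_prop))]
  refine mul_le_mul_of_nonneg_left ?_ (by positivity)
  exact integral_mono (intOn_cube (by fun_prop)) (intOn_cube (gradNorm_cont hf))
    fun x => grad_pt f x w hw2

/-- large-scale estimate on the complement of the ball `B_R`. -/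
theorem stmt_3 (f : R2 → ℝ) (hf : ContDiff ℝ (⊤ : ℕ∞) f) (hper : Per f)
    (R : ℝ) (hR : 0 < R) :
    (∫ x in cube, ∫ z in {z : R2 | en2 z < R}ᶜ, (f (x + z) - f x) ^ 2 / en2 z ^ 3)
      ≤ 2 * π * supNorm f / R * min (4 * supNorm f) (∫ x in cube, gradNorm f x) := by
  have hfc := hf.continuous
  have hM := abs_le_sup hfc hper
  have hM0 : 0 ≤ supNorm f := (abs_nonneg _).trans (hM 0)
  set M := supNorm f with hMdef
  set G := ∫ x in cube, gradNorm f x with hG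
  have hen : Continuous en2 := by unfold en2; fun_prop
  have hS : MeasurableSet {z : R2 | en2 z < R}ᶜ :=
    (measurableSet_lt hen.measurable measurable_const).compl
  have hk := ker_integrable R hR
  have hk0 : ∀ z, 0 ≤ phi R (en2 z) := by
    intro z
    refine Set.indicator_nonneg (fun r hr => ?_) _
    have : 0 < r := lt_of_lt_of_le hR hr
    positivity
  have hsq : ∀ x z, (f (x + z) - f x) ^ 2 ≤ 4 * M ^ 2 := by
    intro x z
    have h1 : |f (x + z) - f x| ≤ 2 * M := by
      have := abs_sub (f (x + z)) (f x)
      linarith [hM (x + z), hM x]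
    rw [← sq_abs]
    nlinarith [abs_nonneg (f (x + z) - f x)]
  have e1 : ∀ x, (∫ z in {z : R2 | en2 z < R}ᶜ, (f (x + z) - f x) ^ 2 / en2 z ^ 3)
      = ∫ z, (f (x + z) - f x) ^ 2 * phi R (en2 z) := by
    intro x
    rw [← integral_indicator hS]
    congr 1
    ext z
    by_cases h : en2 z < R
    · simp [phi, Set.indicator, h]
    · simp [phi, Set.indicator, h, not_lt.1 h, div_eq_mul_inv]
  simp_rw [e1]
  have hprod : Integrable (Function.uncurry fun (x z : R2) => (f (x + z) - f x) ^ 2 * phi R (en2 z))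
      ((volume.restrict cube).prod volume) := by
    have hb : Integrable (fun p : R2 × R2 => phi R (en2 p.2)) ((volume.restrict cube).prod volume) :=
      hk.comp_snd _
    refine hb.bdd_mul (c := 4 * M ^ 2) ?_ ?_
    · exact Continuous.aestronglyMeasurable (by fun_prop)
    · refine Filter.Eventually.of_forall fun p => ?_
      rw [Real.norm_of_nonneg (sq_nonneg _)]
      exact hsq _ _
  rw [integral_integral_swap hprod]
  have e2 : ∀ z, ∫ x in cube, (f (x + z) - f x) ^ 2 * phi R (en2 z) = DD f z * phi R (en2 z) :=
    fun z => integral_mul_const _ _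
  have hDi : Integrable (fun z => DD f z * phi R (en2 z)) := by
    have := hprod.integral_prod_right
    simpa only [Function.uncurry, e2] using this
  simp_rw [e2]
  have hL1 : ∫ z, DD f z * phi R (en2 z) ≤ 4 * M ^ 2 * (2 * π / R) := by
    rw [← ker_integral R hR, ← integral_const_mul]
    refine integral_mono hDi (hk.const_mul _) fun z => mul_le_mul_of_nonneg_right ?_ (hk0 z)
    have : DD f z ≤ ∫ x in cube, 4 * M ^ 2 :=
      integral_mono (intOn_cube (by fun_prop)) (integrable_const _) fun x => hsq x z
    simpa using this
  have hDi' : Integrable (fun z => DD f (refl2 z) * phi R (en2 z)) := by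
    have := (refl_mp.integrable_comp_emb refl_emb).2 hDi
    simpa only [Function.comp_def, en2_refl] using this
  have hrefl : ∫ z, DD f (refl2 z) * phi R (en2 z) = ∫ z, DD f z * phi R (en2 z) := by
    have := refl_mp.integral_comp refl_emb (fun z => DD f z * phi R (en2 z))
    simpa only [en2_refl] using this
  have hL2 : 2 * ∫ z, DD f z * phi R (en2 z) ≤ 2 * M * G * (2 * π / R) := by
    rw [two_mul (∫ z, DD f z * phi R (en2 z))]
    nth_rw 2 [← hrefl]
    rw [← integral_add hDi hDi', ← ker_integral R hR, ← integral_const_mul]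
    refine integral_mono (hDi.add hDi') (hk.const_mul _) fun z => ?_
    have := mul_le_mul_of_nonneg_right (DD_pair hf hper z) (hk0 z)
    simpa only [add_mul] using this
  have hc : 0 ≤ 2 * π * M / R := by positivity
  rw [mul_min_of_nonneg _ _ hc]
  refine le_min (hL1.trans_eq (by ring)) ?_
  have e3 : 2 * M * G * (2 * π / R) = 2 * (2 * π * M / R * G) := by ring
  linarith
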